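/- Characterization of the Berezin integral: Let I : 𝒫_n → 𝔠 be additive and right 𝔠-linear, i.e. I(vα + wβ) = I(v)α + I(w)β for all v, w ∈ 𝒫_n and α, β ∈ 𝔠. Then I is translation invariant — meaning I(v(θ+ω)) = I(v) for all v ∈ 𝒫_n and all ω = (ω₁,…,ωₙ) with ω_j ∈ 𝔠_od, where v(θ+ω) denotes the substitution θ_j ↦ θ_j + ω_j — if and only if I(θ^a) = 0 for every multi-index a ∈ {0,1}^n with |a| ≤ n−1. Moreover, in this case I(v) = I(θ₁⋯θₙ)·v_{1̄} for every v = Σ_a θ^a v_a ∈ 𝒫_n, where v_{1̄} = ∂_{θ_n}⋯∂_{θ_1}v|_{θ=0}. -/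

import Mathlib

set_option synthInstance.maxHeartbeats 1000000
set_option maxHeartbeats 2000000

noncomputable section

/-- The underlying module: countably many generators for `𝔠` plus `n` odd generators `θ`. -/
abbrev GV (n : ℕ) : Type := (ℕ →₀ ℂ) × (Fin n → ℂ)

/-- The big Grassmann algebra `E`, an exterior algebra; `𝒫_n = E`. -/
abbrev GE (n : ℕ) : Type := ExteriorAlgebra ℂ (GV n)

variable (n : ℕ)

/-- The odd generators `θ₁,…,θₙ`. -/
def θg (k : Fin n) : GE n := ExteriorAlgebra.ι ℂ ((0 : ℕ →₀ ℂ), Pi.single k 1)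

/-- The subalgebra `𝔠` generated by the countably many generators. -/
def cAlg : Subalgebra ℂ (GE n) :=
  Algebra.adjoin ℂ (Set.range fun v : ℕ →₀ ℂ => ExteriorAlgebra.ι ℂ (v, (0 : Fin n → ℂ)))

/-- The even part of `E`. -/
def evenPart : Submodule ℂ (GE n) := CliffordAlgebra.evenOdd (0 : QuadraticForm ℂ (GV n)) 0

/-- The odd part of `E`. -/
def oddPart : Submodule ℂ (GE n) := CliffordAlgebra.evenOdd (0 : QuadraticForm ℂ (GV n)) 1

/-- Left odd derivative `∂_{θ_s}`: contraction with the dual functional of `θ_s`. -/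
def Dθ (s : Fin n) : GE n →ₗ[ℂ] GE n :=
  CliffordAlgebra.contractLeft ((LinearMap.proj s).comp (LinearMap.snd ℂ (ℕ →₀ ℂ) (Fin n → ℂ)))

/-- The algebra endomorphism setting all `θ`'s to zero. -/
def evalθ0 : GE n →ₐ[ℂ] GE n :=
  CliffordAlgebra.map ⟨(LinearMap.fst ℂ (ℕ →₀ ℂ) (Fin n → ℂ)).prod 0, fun _ => rfl⟩

/-- The Berezin integral `∫ dθ v = ∂_{θ_n} ⋯ ∂_{θ_1} v |_{θ=0} = v_{1̄}`. -/
def berezin (v : GE n) : GE n :=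
  evalθ0 n ((List.finRange n).foldl (fun w s => Dθ n s w) v)

/-- `θ^a` for a multi-index `a ∈ {0,1}ⁿ`, factors in increasing order. -/
def θpow (a : Fin n → Bool) : GE n :=
  (List.ofFn fun k => if a k then θg n k else 1).prod

/-- `|a|`: the number of `1` entries of the multi-index `a`. -/
def mIdxCard (a : Fin n → Bool) : ℕ := (Finset.univ.filter fun k => a k).card

/-- The ordered product of the `θ_k` with `a k = true`, over `k` in the list `l`. -/
def θprod (a : Fin n → Bool) (l : List (Fin n)) : GE n :=
  (l.map fun k => if a k then θg n k else 1).prod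

theorem θpow_eq_θprod (a : Fin n → Bool) : θpow n a = θprod n a (List.finRange n) := by
  rw [θpow, θprod, List.ofFn_eq_map]

theorem θprod_cons (a : Fin n → Bool) (i : Fin n) (l : List (Fin n)) :
    θprod n a (i :: l) = (if a i then θg n i else 1) * θprod n a l := by
  simp [θprod]

theorem θprod_congr {a b : Fin n → Bool} {l : List (Fin n)} (h : ∀ i ∈ l, a i = b i) :
    θprod n a l = θprod n b l := by
  rw [θprod, θprod, List.map_congr_left fun i hi => by rw [h i hi]]

theorem ι_mul_ι_eq_neg (x y : GV n) :
    (ExteriorAlgebra.ι ℂ x * ExteriorAlgebra.ι ℂ y : GE n)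
      = -(ExteriorAlgebra.ι ℂ y * ExteriorAlgebra.ι ℂ x) :=
  eq_neg_of_add_eq_zero_left (ExteriorAlgebra.ι_add_mul_swap x y)

/-- Vectors commute with products of the `θ_k` up to a sign. -/
theorem exists_ι_mul_θprod (m : GV n) (a : Fin n → Bool) (l : List (Fin n)) :
    ∃ ε : ℂ, ε ≠ 0 ∧ ExteriorAlgebra.ι ℂ m * θprod n a l
      = ε • (θprod n a l * ExteriorAlgebra.ι ℂ m) := by
  induction l with
  | nil => exact ⟨1, one_ne_zero, by simp [θprod]⟩
  | cons i l ih =>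
    obtain ⟨ε, hε, h⟩ := ih
    rw [θprod_cons]
    cases a i with
    | false => exact ⟨ε, hε, by simpa using h⟩
    | true =>
      refine ⟨-ε, neg_ne_zero.2 hε, ?_⟩
      simp only [if_true]
      rw [← mul_assoc, θg, ι_mul_ι_eq_neg, neg_mul, mul_assoc, h, mul_smul_comm, neg_smul,
        mul_assoc]

theorem exists_θg_mul_θprod (k : Fin n) (a : Fin n → Bool) {l : List (Fin n)} (hl : l.Nodup)
    (hk : k ∈ l) : ∃ (ε : ℂ) (b : Fin n → Bool), θg n k * θprod n a l = ε • θprod n b l := by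
  induction l with
  | nil => simp at hk
  | cons i l ih =>
    obtain ⟨hi, hl⟩ := List.nodup_cons.1 hl
    have upd (b : Fin n → Bool) (c : Bool) :
        θprod n (Function.update b i c) l = θprod n b l :=
      θprod_congr n fun j hj => Function.update_of_ne (ne_of_mem_of_not_mem hj hi) _ _
    rw [θprod_cons]
    by_cases hki : k = i
    · subst hki
      cases hak : a k with
      | false =>
        refine ⟨1, Function.update a k true, ?_⟩
        rw [θprod_cons, upd]
        simp
      | true =>
        refine ⟨0, a, ?_⟩
        rw [if_pos rfl, ← mul_assoc, θg, ExteriorAlgebra.ι_sq_zero, zero_mul, zero_smul]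
    · obtain ⟨ε, b, h⟩ := ih hl ((List.mem_cons.1 hk).resolve_left hki)
      cases hai : a i with
      | false =>
        refine ⟨ε, Function.update b i false, ?_⟩
        rw [θprod_cons, upd]
        simpa using h
      | true =>
        refine ⟨-ε, Function.update b i true, ?_⟩
        rw [θprod_cons, upd, Function.update_self, if_pos rfl, ← mul_assoc]
        conv_lhs => rw [θg, θg, ι_mul_ι_eq_neg, ← θg, ← θg]
        rw [neg_mul, mul_assoc, h, mul_smul_comm, neg_smul]

theorem ι_mem_cAlg (x : ℕ →₀ ℂ) : ExteriorAlgebra.ι ℂ (x, (0 : Fin n → ℂ)) ∈ cAlg n :=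
  Algebra.subset_adjoin ⟨x, rfl⟩

theorem ι_eq_add_sum (m : GV n) :
    (ExteriorAlgebra.ι ℂ m : GE n)
      = ExteriorAlgebra.ι ℂ (m.1, (0 : Fin n → ℂ)) + ∑ k, m.2 k • θg n k := by
  simp only [θg, ← map_smul, ← map_sum, ← map_add]
  congr 1
  ext i
  · simp [Prod.fst_sum]
  · simp [Prod.snd_sum, Finset.sum_apply, Pi.single_apply]

/-- Every element is a sum of terms `θ^a α` with `α ∈ 𝔠`. -/
theorem mem_span_θprod (v : GE n) :
    v ∈ Submodule.span ℂ {w : GE n | ∃ a, ∃ α ∈ cAlg n, w = θprod n a (List.finRange n) * α} := by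
  set M := Submodule.span ℂ {w : GE n | ∃ a, ∃ α ∈ cAlg n, w = θprod n a (List.finRange n) * α}
  induction v using CliffordAlgebra.left_induction with
  | algebraMap r =>
    refine Submodule.subset_span
      ⟨fun _ => false, algebraMap ℂ _ r, Subalgebra.algebraMap_mem _ r, ?_⟩
    simp [θprod]
  | add x y hx hy => exact add_mem hx hy
  | ι_mul w m hw =>
    change ExteriorAlgebra.ι ℂ m * w ∈ M
    induction hw using Submodule.span_induction with
    | zero => simp
    | add x y _ _ hx hy => rw [mul_add]; exact add_mem hx hy
    | smul c x _ hx => rw [mul_smul_comm]; exact M.smul_mem c hx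
    | mem x hx =>
      obtain ⟨a, α, hα, rfl⟩ := hx
      rw [ι_eq_add_sum, add_mul, Finset.sum_mul]
      refine add_mem ?_ (sum_mem fun k _ => ?_)
      · obtain ⟨ε, -, h⟩ := exists_ι_mul_θprod n (m.1, 0) a (List.finRange n)
        rw [← mul_assoc, h, smul_mul_assoc, mul_assoc]
        exact M.smul_mem _ (Submodule.subset_span ⟨a, _, mul_mem (ι_mem_cAlg n _) hα, rfl⟩)
      · obtain ⟨ε, b, h⟩ := exists_θg_mul_θprod n k a (List.nodup_finRange n) (List.mem_finRange k)
        rw [smul_mul_assoc, ← mul_assoc, h, smul_mul_assoc]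
        exact M.smul_mem _ (M.smul_mem _ (Submodule.subset_span ⟨b, α, hα, rfl⟩))

theorem Dθ_ι_mul (s : Fin n) (m : GV n) (w : GE n) :
    Dθ n s (ExteriorAlgebra.ι ℂ m * w) = m.2 s • w - ExteriorAlgebra.ι ℂ m * Dθ n s w :=
  CliffordAlgebra.contractLeft_ι_mul _ _ _

/-- `∂_θ` is `𝔠`-linear up to the grading involution. -/
theorem Dθ_mul_of_mem_cAlg (s : Fin n) {x : GE n} (hx : x ∈ cAlg n) (y : GE n) :
    Dθ n s (x * y) = CliffordAlgebra.involute x * Dθ n s y := by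
  rw [cAlg] at hx
  induction hx using Algebra.adjoin_induction generalizing y with
  | mem x hx =>
    obtain ⟨v, rfl⟩ := hx
    have : CliffordAlgebra.involute (ExteriorAlgebra.ι ℂ (v, (0 : Fin n → ℂ)))
        = -ExteriorAlgebra.ι ℂ (v, (0 : Fin n → ℂ)) := CliffordAlgebra.involute_ι _
    rw [this, Dθ_ι_mul]
    simp
  | algebraMap r => rw [AlgHom.commutes, ← Algebra.smul_def, ← Algebra.smul_def, map_smul]
  | add a b _ _ ha hb => rw [add_mul, map_add, map_add, ha, hb, add_mul]
  | mul a b _ _ ha hb => rw [mul_assoc, ha, hb, map_mul, mul_assoc]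

theorem Dθ_of_mem_cAlg (s : Fin n) {x : GE n} (hx : x ∈ cAlg n) : Dθ n s x = 0 := by
  have h : Dθ n s 1 = 0 := CliffordAlgebra.contractLeft_one (Q := 0) _
  simpa [h] using Dθ_mul_of_mem_cAlg n s hx 1

theorem Dθ_θprod_mul (s : Fin n) (a : Fin n → Bool) {l : List (Fin n)} (hs : s ∉ l) {α : GE n}
    (hα : α ∈ cAlg n) : Dθ n s (θprod n a l * α) = 0 := by
  induction l with
  | nil => simpa [θprod] using Dθ_of_mem_cAlg n s hα
  | cons i l ih =>
    rw [List.mem_cons, not_or] at hs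
    rw [θprod_cons, mul_assoc]
    cases a i with
    | false => simpa using ih hs.2
    | true => rw [if_pos rfl, θg, Dθ_ι_mul, ih hs.2]; simp [hs.1]

theorem foldl_Dθ_zero (l : List (Fin n)) : l.foldl (fun w s => Dθ n s w) 0 = 0 := by
  induction l with
  | nil => rfl
  | cons i l ih => simpa using ih

theorem foldl_Dθ_θprod_mul (a : Fin n → Bool) {l : List (Fin n)} (hl : l.Nodup) {α : GE n}
    (hα : α ∈ cAlg n) : l.foldl (fun w s => Dθ n s w) (θprod n a l * α)
      = if ∀ i ∈ l, a i = true then α else 0 := by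
  induction l with
  | nil => simp [θprod]
  | cons i l ih =>
    obtain ⟨hi, hl⟩ := List.nodup_cons.1 hl
    rw [List.foldl_cons, θprod_cons, mul_assoc]
    cases hai : a i with
    | false =>
      simp only [Bool.false_eq_true, if_false, one_mul]
      rw [Dθ_θprod_mul n i a hi hα, foldl_Dθ_zero]
      simp [hai]
    | true =>
      rw [if_pos rfl, θg, Dθ_ι_mul, Dθ_θprod_mul n i a hi hα]
      simp [hai, ih hl]

theorem foldl_Dθ_add (l : List (Fin n)) (v w : GE n) :
    l.foldl (fun w s => Dθ n s w) (v + w)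
      = l.foldl (fun w s => Dθ n s w) v + l.foldl (fun w s => Dθ n s w) w := by
  induction l generalizing v w with
  | nil => rfl
  | cons i l ih => simp [ih]

theorem foldl_Dθ_mem_cAlg (v : GE n) :
    (List.finRange n).foldl (fun w s => Dθ n s w) v ∈ cAlg n := by
  induction mem_span_θprod n v using Submodule.closure_induction with
  | zero => rw [foldl_Dθ_zero]; exact zero_mem _
  | add x y _ _ hx hy => rw [foldl_Dθ_add]; exact add_mem hx hy
  | smul_mem c x hx =>
    obtain ⟨a, α, hα, rfl⟩ := hx
    rw [← mul_smul_comm, foldl_Dθ_θprod_mul n a (List.nodup_finRange n)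
      (Subalgebra.smul_mem _ hα c)]
    split_ifs
    exacts [Subalgebra.smul_mem _ hα c, zero_mem _]

theorem algHom_eq_self_of_mem_cAlg (S : GE n →ₐ[ℂ] GE n)
    (hS : ∀ x : ℕ →₀ ℂ, S (ExteriorAlgebra.ι ℂ (x, (0 : Fin n → ℂ)))
      = ExteriorAlgebra.ι ℂ (x, (0 : Fin n → ℂ))) {x : GE n} (hx : x ∈ cAlg n) : S x = x := by
  rw [cAlg] at hx
  induction hx using Algebra.adjoin_induction with
  | mem x hx => obtain ⟨v, rfl⟩ := hx; exact hS v
  | algebraMap r => exact S.commutes r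
  | add a b _ _ ha hb => rw [map_add, ha, hb]
  | mul a b _ _ ha hb => rw [map_mul, ha, hb]

theorem evalθ0_eq_self_of_mem_cAlg {x : GE n} (hx : x ∈ cAlg n) : evalθ0 n x = x :=
  algHom_eq_self_of_mem_cAlg n _ (fun v => by
    rw [evalθ0]
    exact CliffordAlgebra.map_apply_ι _ _) hx

theorem berezin_add (v w : GE n) : berezin n (v + w) = berezin n v + berezin n w := by
  rw [berezin, foldl_Dθ_add, map_add, berezin, berezin]

theorem berezin_θprod_mul (a : Fin n → Bool) {α : GE n} (hα : α ∈ cAlg n) :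
    berezin n (θprod n a (List.finRange n) * α) = if ∀ i, a i = true then α else 0 := by
  rw [berezin, foldl_Dθ_θprod_mul n a (List.nodup_finRange n) hα]
  simp only [List.mem_finRange, forall_const]
  split_ifs
  exacts [evalθ0_eq_self_of_mem_cAlg n hα, map_zero _]

theorem Dθ_shift {ω : Fin n → GE n} (hω : ∀ j, ω j ∈ cAlg n ∧ ω j ∈ oddPart n)
    {S : GE n →ₐ[ℂ] GE n}
    (hS : ∀ x : ℕ →₀ ℂ, S (ExteriorAlgebra.ι ℂ (x, (0 : Fin n → ℂ)))
      = ExteriorAlgebra.ι ℂ (x, (0 : Fin n → ℂ)))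
    (hSθ : ∀ j, S (θg n j) = θg n j + ω j) (s : Fin n) (v : GE n) :
    Dθ n s (S v) = S (Dθ n s v) := by
  induction v using CliffordAlgebra.left_induction with
  | algebraMap r =>
    rw [AlgHom.commutes, Dθ_of_mem_cAlg n s (Subalgebra.algebraMap_mem _ r), map_zero]
  | add x y hx hy => simp only [map_add, hx, hy]
  | ι_mul w m ih =>
    change Dθ n s (S (ExteriorAlgebra.ι ℂ m * w)) = S (Dθ n s (ExteriorAlgebra.ι ℂ m * w))
    set u : GE n := ∑ k, m.2 k • ω k
    have hSm : S (ExteriorAlgebra.ι ℂ m) = ExteriorAlgebra.ι ℂ m + u := by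
      rw [ι_eq_add_sum, map_add, hS, map_sum]
      simp only [map_smul, hSθ, smul_add, Finset.sum_add_distrib, u, add_assoc]
    have hu : u ∈ cAlg n := sum_mem fun k _ => Subalgebra.smul_mem _ (hω k).1 _
    have hu' : u ∈ oddPart n := sum_mem fun k _ => Submodule.smul_mem _ _ (hω k).2
    rw [map_mul, hSm, add_mul, map_add, Dθ_ι_mul, Dθ_ι_mul, Dθ_mul_of_mem_cAlg n s hu,
      CliffordAlgebra.involute_eq_of_mem_odd hu', ih, map_sub, map_mul, map_smul, hSm, add_mul]
    noncomm_ring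

theorem berezin_shift {ω : Fin n → GE n} (hω : ∀ j, ω j ∈ cAlg n ∧ ω j ∈ oddPart n)
    {S : GE n →ₐ[ℂ] GE n}
    (hS : ∀ x : ℕ →₀ ℂ, S (ExteriorAlgebra.ι ℂ (x, (0 : Fin n → ℂ)))
      = ExteriorAlgebra.ι ℂ (x, (0 : Fin n → ℂ)))
    (hSθ : ∀ j, S (θg n j) = θg n j + ω j) (v : GE n) : berezin n (S v) = berezin n v := by
  have h (l : List (Fin n)) (w : GE n) : l.foldl (fun w s => Dθ n s w) (S w)
      = S (l.foldl (fun w s => Dθ n s w) w) := by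
    induction l generalizing w with
    | nil => rfl
    | cons i l ih => rw [List.foldl_cons, Dθ_shift n hω hS hSθ, ih, List.foldl_cons]
  rw [berezin, h, algHom_eq_self_of_mem_cAlg n S hS (foldl_Dθ_mem_cAlg n v), berezin]

/-- An element of `𝔠` involves only finitely many generators. -/
theorem exists_contractRight_eq_zero {x : GE n} (hx : x ∈ cAlg n) :
    ∃ N : ℕ, ∀ M, N ≤ M → CliffordAlgebra.contractRight x
      ((Finsupp.lapply M).comp (LinearMap.fst ℂ (ℕ →₀ ℂ) (Fin n → ℂ))) = 0 := by
  rw [cAlg, ← Subalgebra.mem_toSubmodule, Algebra.adjoin_eq_span] at hx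
  induction hx using Submodule.span_induction with
  | zero => exact ⟨0, fun M _ => by simp⟩
  | add a b _ _ ha hb =>
    obtain ⟨N₁, h₁⟩ := ha
    obtain ⟨N₂, h₂⟩ := hb
    refine ⟨max N₁ N₂, fun M hM => ?_⟩
    rw [map_add, LinearMap.add_apply, h₁ M (by omega), h₂ M (by omega), add_zero]
  | smul c a _ ha =>
    obtain ⟨N, h⟩ := ha
    refine ⟨N, fun M hM => ?_⟩
    rw [map_smul, LinearMap.smul_apply, h M hM, smul_zero]
  | mem x hx =>
    induction hx using Submonoid.closure_induction_right with
    | one => exact ⟨0, fun M _ => CliffordAlgebra.contractRight_one (Q := 0) _⟩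
    | mul_right y _ z hz ih =>
      obtain ⟨N, h⟩ := ih
      obtain ⟨v, rfl⟩ := hz
      obtain ⟨N', h'⟩ := v.support.bddAbove
      refine ⟨max N (N' + 1), fun M hM => ?_⟩
      have hv : v M = 0 := by
        by_contra hne
        have := h' (Finset.mem_coe.2 (Finsupp.mem_support_iff.2 hne))
        omega
      refine (CliffordAlgebra.contractRight_mul_ι _ _ _).trans ?_
      rw [h M (by omega)]
      simp [hv]

/-- An element of `𝔠` annihilated by all generators vanishes. -/
theorem eq_zero_of_mul_ι_eq_zero {x : GE n} (hx : x ∈ cAlg n)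
    (h : ∀ N, x * ExteriorAlgebra.ι ℂ (Finsupp.single N (1 : ℂ), (0 : Fin n → ℂ)) = 0) :
    x = 0 := by
  obtain ⟨N, hN⟩ := exists_contractRight_eq_zero n hx
  have h₁ := CliffordAlgebra.contractRight_mul_ι (Q := (0 : QuadraticForm ℂ (GV n)))
    (d := (Finsupp.lapply N).comp (LinearMap.fst ℂ (ℕ →₀ ℂ) (Fin n → ℂ)))
    (Finsupp.single N (1 : ℂ), (0 : Fin n → ℂ)) x
  rw [hN N le_rfl] at h₁
  have h₂ : x * CliffordAlgebra.ι (0 : QuadraticForm ℂ (GV n))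
    (Finsupp.single N (1 : ℂ), (0 : Fin n → ℂ)) = 0 := h N
  rw [h₂] at h₁
  simpa using h₁.symm

theorem algHom_θprod_eq_self (S : GE n →ₐ[ℂ] GE n) {k : Fin n} (a : Fin n → Bool)
    (hS : ∀ j, j ≠ k → S (θg n j) = θg n j) {l : List (Fin n)} (hk : k ∉ l) :
    S (θprod n a l) = θprod n a l := by
  induction l with
  | nil => simp [θprod]
  | cons i l ih =>
    rw [List.mem_cons, not_or] at hk
    rw [θprod_cons, map_mul, ih hk.2]
    cases a i
    · simp
    · simp [hS i (Ne.symm hk.1)]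

/-- Effect of a shift in the single variable `θ_k` on a product containing `θ_k`. -/
theorem exists_algHom_θprod (S : GE n →ₐ[ℂ] GE n) {k : Fin n} (m : GV n) (a : Fin n → Bool)
    (hS : ∀ j, j ≠ k → S (θg n j) = θg n j) (hSk : S (θg n k) = θg n k + ExteriorAlgebra.ι ℂ m)
    (hak : a k = false) {l : List (Fin n)} (hl : l.Nodup) (hk : k ∈ l) :
    ∃ ε : ℂ, ε ≠ 0 ∧ S (θprod n (Function.update a k true) l)
      = θprod n (Function.update a k true) l + ε • (θprod n a l * ExteriorAlgebra.ι ℂ m) := by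
  induction l with
  | nil => simp at hk
  | cons i l ih =>
    obtain ⟨hi, hl⟩ := List.nodup_cons.1 hl
    simp only [θprod_cons]
    by_cases hki : k = i
    · subst hki
      obtain ⟨ε, hε, h⟩ := exists_ι_mul_θprod n m a l
      have upd : θprod n (Function.update a k true) l = θprod n a l :=
        θprod_congr n fun j hj => Function.update_of_ne (ne_of_mem_of_not_mem hj hi) _ _
      refine ⟨ε, hε, ?_⟩
      rw [upd, Function.update_self, if_pos rfl, map_mul, hSk, algHom_θprod_eq_self n S a hS hi,
        add_mul, h, hak]
      simp
    · obtain ⟨ε, hε, h⟩ := ih hl ((List.mem_cons.1 hk).resolve_left hki)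
      refine ⟨ε, hε, ?_⟩
      have hSi : S (if a i then θg n i else 1) = if a i then θg n i else 1 := by
        cases a i
        · simp
        · simp [hS i (Ne.symm hki)]
      rw [Function.update_of_ne (Ne.symm hki), map_mul, hSi, h, mul_add, mul_smul_comm, mul_assoc]

/-- The substitution `θ_k ↦ θ_k + ι x`. -/
def shiftHom (k : Fin n) (x : ℕ →₀ ℂ) : GE n →ₐ[ℂ] GE n :=
  ExteriorAlgebra.map (LinearMap.id + (LinearMap.inl ℂ (ℕ →₀ ℂ) (Fin n → ℂ)).comp
    (((LinearMap.proj k).comp (LinearMap.snd ℂ (ℕ →₀ ℂ) (Fin n → ℂ))).smulRight x))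

theorem shiftHom_ι (k : Fin n) (x : ℕ →₀ ℂ) (m : GV n) :
    shiftHom n k x (ExteriorAlgebra.ι ℂ m)
      = ExteriorAlgebra.ι ℂ m + m.2 k • ExteriorAlgebra.ι ℂ (x, (0 : Fin n → ℂ)) := by
  rw [shiftHom, ExteriorAlgebra.map_apply_ι, ← map_smul, ← map_add]
  simp

theorem ι_mem_oddPart (m : GV n) : ExteriorAlgebra.ι ℂ m ∈ oddPart n :=
  CliffordAlgebra.ι_mem_evenOdd_one _ m

theorem mIdxCard_lt_iff (a : Fin n → Bool) : mIdxCard n a < n ↔ ¬ ∀ i, a i = true := by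
  rw [mIdxCard]
  have h₁ := Finset.card_filter_le (Finset.univ : Finset (Fin n)) (fun k => a k = true)
  have h₂ := Finset.card_filter_eq_iff (s := (Finset.univ : Finset (Fin n)))
    (p := fun k => a k = true)
  rw [Finset.card_fin] at h₁ h₂
  rw [lt_iff_le_and_ne, Ne, h₂]
  simp [h₁]

/-- **Characterization of the Berezin integral.**
Let `I : 𝒫_n → 𝔠` be additive and right `𝔠`-linear.  Then `I` is translation invariant
(`I(v(θ+ω)) = I(v)` for all `v` and all odd shifts `ω` with entries in `𝔠_od`, the substitution
being realized by any algebra endomorphism `S` fixing the generators of `𝔠` and sending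
`θ_j ↦ θ_j + ω_j`) if and only if `I(θ^a) = 0` for every multi-index `a` with `|a| ≤ n-1`.
Moreover, in this case `I(v) = I(θ₁⋯θₙ)·v_{1̄}` for every `v`, where `v_{1̄}` is the Berezin
integral (top coefficient) of `v`. -/
theorem berezin_characterization (I : GE n → GE n)
    (hImem : ∀ v, I v ∈ cAlg n)
    (hIlin : ∀ v w α β : GE n, α ∈ cAlg n → β ∈ cAlg n →
      I (v * α + w * β) = I v * α + I w * β) :
    ((∀ (ω : Fin n → GE n), (∀ j, ω j ∈ cAlg n ∧ ω j ∈ oddPart n) →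
        ∀ S : GE n →ₐ[ℂ] GE n,
          (∀ x : ℕ →₀ ℂ, S (ExteriorAlgebra.ι ℂ (x, (0 : Fin n → ℂ)))
            = ExteriorAlgebra.ι ℂ (x, (0 : Fin n → ℂ))) →
          (∀ j, S (θg n j) = θg n j + ω j) →
          ∀ v, I (S v) = I v)
      ↔ (∀ a : Fin n → Bool, mIdxCard n a < n → I (θpow n a) = 0))
    ∧ ((∀ a : Fin n → Bool, mIdxCard n a < n → I (θpow n a) = 0) →
        ∀ v, I v = I (θpow n (fun _ => true)) * berezin n v) := by
  have hmul (v α : GE n) (hα : α ∈ cAlg n) : I (v * α) = I v * α := by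
    simpa using hIlin v 0 α 0 hα (zero_mem _)
  have hadd (v w : GE n) : I (v + w) = I v + I w := by
    simpa using hIlin v w 1 1 (one_mem _) (one_mem _)
  have formula (h : ∀ a : Fin n → Bool, mIdxCard n a < n → I (θpow n a) = 0) (v : GE n) :
      I v = I (θpow n (fun _ => true)) * berezin n v := by
    have key (a : Fin n → Bool) (α : GE n) (hα : α ∈ cAlg n) :
        I (θprod n a (List.finRange n) * α) = I (θpow n (fun _ => true))
          * berezin n (θprod n a (List.finRange n) * α) := by
      rw [hmul _ _ hα, berezin_θprod_mul n a hα, ← θpow_eq_θprod]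
      split_ifs with ha
      · rw [show a = fun _ => true from funext ha]
      · rw [h a ((mIdxCard_lt_iff n a).2 ha), zero_mul, mul_zero]
    induction mem_span_θprod n v using Submodule.closure_induction with
    | zero => simpa using key (fun _ => true) 0 (zero_mem _)
    | add x y _ _ hx hy => rw [hadd, berezin_add, mul_add, hx, hy]
    | smul_mem c x hx =>
      obtain ⟨a, α, hα, rfl⟩ := hx
      rw [← mul_smul_comm]
      exact key a _ (Subalgebra.smul_mem _ hα c)
  refine ⟨⟨fun hinv a ha => ?_, fun h ω hω S hS hSθ v => ?_⟩, formula⟩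
  · obtain ⟨k, hk⟩ := not_forall.1 ((mIdxCard_lt_iff n a).1 ha)
    refine eq_zero_of_mul_ι_eq_zero n (hImem _) fun N => ?_
    set x : ℕ →₀ ℂ := Finsupp.single N 1
    have hθ (j : Fin n) : shiftHom n k x (θg n j)
        = θg n j + if j = k then ExteriorAlgebra.ι ℂ (x, (0 : Fin n → ℂ)) else 0 := by
      rw [θg, shiftHom_ι]
      by_cases hj : j = k
      · simp [hj]
      · simp [hj, Ne.symm hj]
    obtain ⟨ε, hε, h⟩ := exists_algHom_θprod n (shiftHom n k x) (k := k) (x, 0) a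
      (fun j hj => by simp [hθ, hj]) (by simp [hθ]) (by simpa using hk)
      (List.nodup_finRange n) (List.mem_finRange k)
    have hI := hinv _ (fun j => by
      split_ifs
      exacts [⟨ι_mem_cAlg n x, ι_mem_oddPart n _⟩, ⟨zero_mem _, zero_mem _⟩])
      (shiftHom n k x) (fun y => by rw [shiftHom_ι]; simp) hθ
      (θprod n (Function.update a k true) (List.finRange n))
    rw [h, hadd, add_eq_left, ← mul_smul_comm,
      hmul _ _ (Subalgebra.smul_mem _ (ι_mem_cAlg n x) ε), mul_smul_comm, ← θpow_eq_θprod] at hI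
    exact (smul_eq_zero.1 hI).resolve_left hε
  · rw [formula h, formula h v, berezin_shift n hω hS hSθ]
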